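/- arXiv:2301.08158 — 2 statements merged into one kernel-verified Lean document; each statement's English description precedes it below -/
import Mathlib

section
/- Shift-and-rescale credible sets are asymptotically efficient confidence intervals: Let 0 < α_n < 1 with n α_n → ∞, V > 0, δ ∈ (0,1). Suppose (i) the pushforward of the random probability measure μ_n^Y (the marginal α_n-posterior law of ψ(η)) under x ↦ √(n α_n)(x − ψ̂_n) converges weakly in P₀-probability to N(0,V); (ii) √n(ψ̂_n − ψ(η₀)) converges in distribution to N(0,V); and (iii) the centering estimators satisfy √n(ψ̄_n − ψ̂_n) → 0 in P₀-probability. Let a_{n,δ}^Y denote the δ-quantile of μ_n^Y and define the shift-and-rescale set 𝒥_n = ( √α_n (a_{n,δ/2}^Y − ψ̄_n) + ψ̄_n , √α_n (a_{n,1−δ/2}^Y − ψ̄_n) + ψ̄_n ]. Then P₀( ψ(η₀) ∈ 𝒥_n ) → 1 − δ as n → ∞. -/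
open MeasureTheory ProbabilityTheory Filter Set

/-- The bounded-Lipschitz distance between two (probability) measures on `ℝ`. -/
noncomputable def dBL (μ ν : Measure ℝ) : ℝ :=
  ⨆ f : {f : ℝ → ℝ // LipschitzWith 1 f ∧ ∀ x, |f x| ≤ 1},
    |∫ x, f.1 x ∂μ - ∫ x, f.1 x ∂ν|

/-- The `p`-quantile of a probability measure on `ℝ`: `inf {x : Q(−∞, x] ≥ p}`. -/
noncomputable def quantile (Q : Measure ℝ) (p : ℝ) : ℝ :=
  sInf {x : ℝ | p ≤ (Q (Set.Iic x)).toReal}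

lemma le_dBL (μ ν : Measure ℝ) [IsFiniteMeasure μ] [IsFiniteMeasure ν] {f : ℝ → ℝ}
    (hf : LipschitzWith 1 f) (hb : ∀ x, |f x| ≤ 1) :
    |∫ x, f x ∂μ - ∫ x, f x ∂ν| ≤ dBL μ ν := by
  refine le_ciSup (f := fun g : {f : ℝ → ℝ // LipschitzWith 1 f ∧ ∀ x, |f x| ≤ 1} =>
    |∫ x, g.1 x ∂μ - ∫ x, g.1 x ∂ν|) ⟨μ.real univ + ν.real univ, ?_⟩ ⟨f, hf, hb⟩
  rintro _ ⟨g, rfl⟩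
  have hbound : ∀ ρ : Measure ℝ, IsFiniteMeasure ρ → |∫ x, g.1 x ∂ρ| ≤ ρ.real univ := by
    intro ρ _
    simpa using norm_integral_le_of_norm_le_const (μ := ρ) (f := g.1) (C := 1)
      (ae_of_all _ g.2.2)
  exact (abs_sub _ _).trans (add_le_add (hbound μ inferInstance) (hbound ν inferInstance))

/-- The ramp `t ↦ max 0 (min ε (x + ε - t))` is an admissible test function, so distribution
functions of finite measures are compared by `dBL` after a shift by `ε`. -/
lemma measureReal_Iic_le_add_dBL_div (μ ν : Measure ℝ) [IsFiniteMeasure μ] [IsFiniteMeasure ν]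
    (x : ℝ) {ε : ℝ} (h0 : 0 < ε) (h1 : ε ≤ 1) :
    μ.real (Iic x) ≤ ν.real (Iic (x + ε)) + dBL μ ν / ε ∧
      ν.real (Iic x) ≤ μ.real (Iic (x + ε)) + dBL μ ν / ε := by
  let f : ℝ → ℝ := fun t => max 0 (min ε (x + ε - t))
  have hLip : LipschitzWith 1 f := by
    refine LipschitzWith.const_max (LipschitzWith.const_min ?_ ε) 0
    refine LipschitzWith.of_dist_le_mul fun s t => ?_
    rw [Real.dist_eq, Real.dist_eq, abs_sub_comm s t]
    simp
  have hf0 : ∀ t, 0 ≤ f t := fun t => le_max_left _ _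
  have hfε : ∀ t, f t ≤ ε := fun t => max_le h0.le (min_le_left _ _)
  have hbd : ∀ t, |f t| ≤ 1 := fun t => by
    rw [abs_of_nonneg (hf0 t)]; exact (hfε t).trans h1
  have hint : ∀ (ρ : Measure ℝ) [IsFiniteMeasure ρ], Integrable f ρ := fun ρ _ =>
    Integrable.of_bound hLip.continuous.aestronglyMeasurable 1 (ae_of_all _ hbd)
  have hlow : ∀ (ρ : Measure ℝ) [IsFiniteMeasure ρ], ε * ρ.real (Iic x) ≤ ∫ t, f t ∂ρ := by
    intro ρ _
    have : ∫ t, (Iic x).indicator (fun _ => ε) t ∂ρ ≤ ∫ t, f t ∂ρ := by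
      refine integral_mono ((integrable_const ε).indicator measurableSet_Iic) (hint ρ) fun t => ?_
      by_cases ht : t ∈ Iic x
      · rw [indicator_of_mem ht]
        exact le_max_of_le_right (le_min le_rfl (by have := mem_Iic.1 ht; linarith))
      · rw [indicator_of_notMem ht]; exact hf0 t
    rwa [integral_indicator_const _ measurableSet_Iic, smul_eq_mul, mul_comm] at this
  have hupp : ∀ (ρ : Measure ℝ) [IsFiniteMeasure ρ],
      ∫ t, f t ∂ρ ≤ ε * ρ.real (Iic (x + ε)) := by
    intro ρ _
    have : ∫ t, f t ∂ρ ≤ ∫ t, (Iic (x + ε)).indicator (fun _ => ε) t ∂ρ := by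
      refine integral_mono (hint ρ) ((integrable_const ε).indicator measurableSet_Iic) fun t => ?_
      by_cases ht : t ∈ Iic (x + ε)
      · rw [indicator_of_mem ht]; exact hfε t
      · rw [indicator_of_notMem ht]
        refine max_le le_rfl ((min_le_right _ _).trans ?_)
        have := not_le.1 (fun h => ht (mem_Iic.2 h)); linarith
    rwa [integral_indicator_const _ measurableSet_Iic, smul_eq_mul, mul_comm] at this
  have hdist : |∫ t, f t ∂μ - ∫ t, f t ∂ν| ≤ dBL μ ν :=
    le_dBL μ ν hLip hbd
  have hd := abs_le.1 hdist
  have key : ∀ a b : ℝ, ε * a ≤ ε * b + dBL μ ν → a ≤ b + dBL μ ν / ε := by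
    intro a b h
    rw [← mul_le_mul_iff_of_pos_left h0, mul_add, mul_div_cancel₀ _ h0.ne']
    exact h
  exact ⟨key _ _ (by linarith [hlow μ, hupp ν]), key _ _ (by linarith [hlow ν, hupp μ])⟩

lemma quantile_le {Q : Measure ℝ} [IsProbabilityMeasure Q] {p y : ℝ} (hp : 0 < p)
    (h : p ≤ Q.real (Iic y)) : quantile Q p ≤ y := by
  refine csInf_le ?_ h
  have hlim := tendsto_cdf_atBot Q
  obtain ⟨b, hb⟩ := (hlim.eventually (gt_mem_nhds hp)).exists
  refine ⟨b, fun x hx => ?_⟩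
  by_contra! hxb
  have := monotone_cdf Q hxb.le
  rw [cdf_eq_real, cdf_eq_real] at this
  rw [cdf_eq_real] at hb
  exact absurd (hx.trans this) (not_le.2 hb)

lemma le_quantile {Q : Measure ℝ} [IsProbabilityMeasure Q] {p y : ℝ} (hp : p < 1)
    (h : Q.real (Iic y) < p) : y ≤ quantile Q p := by
  have hlim := tendsto_cdf_atTop Q
  obtain ⟨b, hb⟩ := (hlim.eventually (lt_mem_nhds hp)).exists
  rw [cdf_eq_real] at hb
  refine le_csInf ⟨b, hb.le⟩ fun x hx => ?_
  by_contra! hxy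
  exact absurd (hx.trans (measureReal_mono (Iic_subset_Iic.2 hxy.le))) (not_le.2 h)

lemma continuous_cdf (Q : Measure ℝ) [IsProbabilityMeasure Q] [NullSingletonClass Q] :
    Continuous (cdf Q) := by
  refine continuous_iff_continuousAt.2 fun x => ?_
  refine continuousAt_iff_continuous_left'_right'.2 ⟨?_, ?_⟩
  · rw [(cdf Q).mono.continuousWithinAt_Iio_iff_leftLim_eq]
    have h := (cdf Q).measure_singleton x
    rw [measure_cdf, measure_singleton] at h
    have h' := ENNReal.ofReal_eq_zero.1 h.symm
    exact le_antisymm ((cdf Q).mono.leftLim_le le_rfl) (by linarith)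
  · exact ((cdf Q).right_continuous x).mono Ioi_subset_Ici_self

lemma strictMono_cdf_gaussianReal (m : ℝ) {v : NNReal} (hv : v ≠ 0) :
    StrictMono (cdf (gaussianReal m v)) := by
  intro a b hab
  rw [cdf_eq_real, cdf_eq_real, ← sub_pos, ← measureReal_sdiff (Iic_subset_Iic.2 hab.le)
    measurableSet_Iic, Iic_sdiff_Iic]
  refine ENNReal.toReal_pos (fun h => ?_) (measure_ne_top _ _)
  have := gaussianReal_absolutelyContinuous' m hv h
  rw [Real.volume_Ioc, ENNReal.ofReal_eq_zero] at this
  linarith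

lemma exists_cdf_eq (Q : Measure ℝ) [IsProbabilityMeasure Q] [NullSingletonClass Q] {p : ℝ}
    (h0 : 0 < p) (h1 : p < 1) : ∃ z, cdf Q z = p := by
  obtain ⟨a, ha⟩ := ((tendsto_cdf_atBot Q).eventually (gt_mem_nhds h0)).exists
  obtain ⟨b, hb⟩ := ((tendsto_cdf_atTop Q).eventually (lt_mem_nhds h1)).exists
  exact mem_range_of_exists_le_of_exists_ge (continuous_cdf Q) ⟨a, ha.le⟩ ⟨b, hb.le⟩

lemma cdf_gaussianReal_zero_neg {v : NNReal} (hv : v ≠ 0) (z : ℝ) :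
    cdf (gaussianReal 0 v) (-z) = 1 - cdf (gaussianReal 0 v) z := by
  have := nullSingletonClass_gaussianReal (μ := 0) hv
  rw [cdf_eq_real, cdf_eq_real, ← probReal_compl_eq_one_sub measurableSet_Iic, compl_Iic]
  conv_lhs => rw [← neg_zero, ← gaussianReal_map_neg]
  rw [map_measureReal_apply measurable_neg measurableSet_Iic]
  have : (fun x : ℝ => -x) ⁻¹' Iic (-z) = Ici z := by ext; simp
  rw [this]
  exact measureReal_congr Ioi_ae_eq_Ici.symm

/-- Weak convergence in the bounded-Lipschitz metric to an atomless law implies pointwise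
convergence of distribution functions. -/
lemma tendsto_measureReal_Iic_of_dBL (ν : ℕ → Measure ℝ) [∀ n, IsFiniteMeasure (ν n)]
    (G : Measure ℝ) [IsProbabilityMeasure G] [NullSingletonClass G]
    (h : Tendsto (fun n => dBL (ν n) G) atTop (nhds 0)) (x : ℝ) :
    Tendsto (fun n => (ν n).real (Iic x)) atTop (nhds (cdf G x)) := by
  refine Metric.tendsto_nhds.2 fun κ hκ => ?_
  obtain ⟨d, hd, hdc⟩ := Metric.continuousAt_iff.1 (continuous_cdf G).continuousAt (κ / 2)
    (half_pos hκ)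
  obtain ⟨ε, hε0, hε⟩ := exists_between (lt_min hd one_pos)
  have hεd := hε.trans_le (min_le_left _ _)
  have hε1 := (hε.trans_le (min_le_right _ _)).le
  have hp : |cdf G (x + ε) - cdf G x| < κ / 2 :=
    hdc (by rw [Real.dist_eq]; simpa [abs_of_pos hε0] using hεd)
  have hm : |cdf G (x - ε) - cdf G x| < κ / 2 :=
    hdc (by rw [Real.dist_eq]; simpa [abs_of_pos hε0] using hεd)
  filter_upwards [h.eventually (gt_mem_nhds (mul_pos hε0 (half_pos hκ)))] with n hn
  have hn' : dBL (ν n) G / ε < κ / 2 := by rwa [div_lt_iff₀' hε0]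
  have h1 := (measureReal_Iic_le_add_dBL_div (ν n) G x hε0 hε1).1
  have h2 := (measureReal_Iic_le_add_dBL_div (ν n) G (x - ε) hε0 hε1).2
  rw [sub_add_cancel] at h2
  rw [← cdf_eq_real G] at h1 h2
  rw [abs_lt] at hp hm
  rw [Real.dist_eq, abs_lt]
  constructor <;> linarith [hp.1, hp.2, hm.1, hm.2]

/-- Quantiles depend continuously on the law at an atomless limit with strictly increasing
distribution function, up to an affine reparametrisation. -/
lemma exists_dBL_bound_quantile (G : Measure ℝ) [IsProbabilityMeasure G]
    (hG : StrictMono (cdf G)) {z ε : ℝ} (h0 : 0 < cdf G z) (h1 : cdf G z < 1) (hε : 0 < ε) :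
    ∃ η > 0, ∀ (μ : Measure ℝ) [IsProbabilityMeasure μ] (c t : ℝ), 0 < c →
      dBL (μ.map fun x => c * (x - t)) G ≤ η →
        |c * (quantile μ (cdf G z) - t) - z| ≤ ε := by
  obtain ⟨e, he0, he⟩ := exists_between (lt_min (half_pos hε) one_pos)
  have heε := he.trans_le (min_le_left _ _)
  have he1 := (he.trans_le (min_le_right _ _)).le
  have hup := sub_pos.2 (hG (show z < z + e by linarith))
  have hlo := sub_pos.2 (hG (show z - e < z by linarith))
  obtain ⟨η', hη0, hη⟩ := exists_between (lt_min hup hlo)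
  refine ⟨e * η', mul_pos he0 hη0, fun μ _ c t hc hd => ?_⟩
  have hmeas : Measurable fun x : ℝ => c * (x - t) := by fun_prop
  have hν : ∀ y, (μ.map fun x => c * (x - t)).real (Iic y) = μ.real (Iic (t + y / c)) := by
    intro y
    rw [map_measureReal_apply hmeas measurableSet_Iic]
    congr 1
    ext x
    rw [mem_preimage, mem_Iic, mem_Iic, ← le_div_iff₀' hc, sub_le_iff_le_add']
  have hd' : dBL (μ.map fun x => c * (x - t)) G / e ≤ η' := by rwa [div_le_iff₀' he0]
  have hη1 := hη.trans_le (min_le_left _ _)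
  have hη2 := hη.trans_le (min_le_right _ _)
  have k1 := (measureReal_Iic_le_add_dBL_div (μ.map fun x => c * (x - t)) G (z - e - e) he0 he1).1
  have k2 := (measureReal_Iic_le_add_dBL_div (μ.map fun x => c * (x - t)) G (z + e) he0 he1).2
  rw [sub_add_cancel] at k1
  rw [hν, ← cdf_eq_real G] at k1 k2
  have u := quantile_le h0 (show cdf G z ≤ μ.real (Iic (t + (z + e + e) / c)) by linarith)
  have l := le_quantile h1 (show μ.real (Iic (t + (z - e - e) / c)) < cdf G z by linarith)
  rw [← sub_le_iff_le_add', le_div_iff₀' hc] at u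
  rw [← le_sub_iff_add_le', div_le_iff₀' hc] at l
  rw [abs_le]
  constructor <;> linarith

/-- **Shift-and-rescale credible sets are asymptotically efficient confidence intervals.**
If the `αₙ`-posterior of `ψ(η)` satisfies a BvM theorem at rate `√(n αₙ)` around `ψ̂ₙ`,
`√n (ψ̂ₙ − ψ(η₀))` is asymptotically `N(0,V)`, and the centering satisfies
`√n (ψ̄ₙ − ψ̂ₙ) → 0` in `P₀`-probability, then the shift-and-rescale set
`𝒥ₙ = (√αₙ (a_{n,δ/2} − ψ̄ₙ) + ψ̄ₙ , √αₙ (a_{n,1−δ/2} − ψ̄ₙ) + ψ̄ₙ]` has asymptotic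
coverage `1 − δ`. -/
theorem shift_and_rescale_efficient_confidence
    (Ω : ℕ → Type*) [∀ n, MeasurableSpace (Ω n)]
    (P : ∀ n, Measure (Ω n)) (hP : ∀ n, IsProbabilityMeasure (P n))
    -- the marginal `αₙ`-posterior distribution of `ψ(η)`
    (μpost : ∀ n, Ω n → Measure ℝ) (hμprob : ∀ n ω, IsProbabilityMeasure (μpost n ω))
    (ψhat ψbar : ∀ n, Ω n → ℝ) (ψ₀ : ℝ)
    (α : ℕ → ℝ) (hα : ∀ n, 0 < α n ∧ α n < 1)
    (hnα : Tendsto (fun n : ℕ => (n : ℝ) * α n) atTop atTop)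
    (V : ℝ) (hV : 0 < V) (δ : ℝ) (hδ : δ ∈ Set.Ioo (0 : ℝ) 1)
    -- (i) BvM: the pushforward of `μpost` under `x ↦ √(n αₙ)(x − ψ̂ₙ)` converges weakly in
    -- `P₀`-probability to `N(0, V)`
    (hBvM : ∀ ε > (0 : ℝ),
      Tendsto (fun n => P n {ω |
        ε < dBL
          (Measure.map (fun x => Real.sqrt ((n : ℝ) * α n) * (x - ψhat n ω)) (μpost n ω))
          (gaussianReal 0 (Real.toNNReal V))})
        atTop (nhds 0))
    -- (ii) `√n (ψ̂ₙ − ψ(η₀))` converges in distribution to `N(0, V)`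
    (hCLT : Tendsto (fun n : ℕ =>
        dBL (Measure.map (fun ω => Real.sqrt n * (ψhat n ω - ψ₀)) (P n))
          (gaussianReal 0 (Real.toNNReal V)))
      atTop (nhds 0))
    -- (iii) `√n (ψ̄ₙ − ψ̂ₙ) → 0` in `P₀`-probability
    (hbar : ∀ ε > (0 : ℝ),
      Tendsto (fun n : ℕ => P n {ω | ε < |Real.sqrt n * (ψbar n ω - ψhat n ω)|})
        atTop (nhds 0)) :
    -- conclusion: asymptotic coverage `1 − δ` of the shift-and-rescale set `𝒥ₙ`
    Tendsto (fun n : ℕ => (P n {ω | ψ₀ ∈ Set.Ioc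
        (Real.sqrt (α n) * (quantile (μpost n ω) (δ / 2) - ψbar n ω) + ψbar n ω)
        (Real.sqrt (α n) * (quantile (μpost n ω) (1 - δ / 2) - ψbar n ω) + ψbar n ω)}).toReal)
      atTop (nhds (1 - δ)) := by
  have hv : Real.toNNReal V ≠ 0 := (Real.toNNReal_pos.2 hV).ne'
  set G := gaussianReal 0 (Real.toNNReal V) with hGdef
  have : NullSingletonClass G := nullSingletonClass_gaussianReal hv
  have hmono : StrictMono (cdf G) := strictMono_cdf_gaussianReal 0 hv
  obtain ⟨hδ0, hδ1⟩ := hδ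
  obtain ⟨z₁, hz₁⟩ := exists_cdf_eq G (p := δ / 2) (by linarith) (by linarith)
  obtain ⟨z₂, hz₂⟩ := exists_cdf_eq G (p := 1 - δ / 2) (by linarith) (by linarith)
  have hlimit : cdf G (-z₁) - cdf G (-z₂) = 1 - δ := by
    rw [cdf_gaussianReal_zero_neg hv, cdf_gaussianReal_zero_neg hv, ← hGdef, hz₁, hz₂]
    ring
  let Z : ∀ n, Ω n → ℝ := fun n ω => Real.sqrt n * (ψhat n ω - ψ₀)
  have hZmeas : ∀ᶠ n in atTop, AEMeasurable (Z n) (P n) := by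
    filter_upwards [hCLT.eventually (gt_mem_nhds one_pos)] with n hn
    by_contra hZ
    rw [Measure.map_of_not_aemeasurable hZ] at hn
    have := le_dBL 0 G (f := fun _ => 1) (LipschitzWith.const' 1) (by simp)
    simp at this
    linarith
  have hZlim : ∀ a b, a ≤ b → Tendsto (fun n => (P n).real {ω | Z n ω ∈ Ioc a b}) atTop
      (nhds (cdf G b - cdf G a)) := by
    intro a b hab
    refine ((tendsto_measureReal_Iic_of_dBL _ G hCLT b).sub
      (tendsto_measureReal_Iic_of_dBL _ G hCLT a)).congr' ?_
    filter_upwards [hZmeas] with n hn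
    rw [← measureReal_sdiff (Iic_subset_Iic.2 hab) measurableSet_Iic, Iic_sdiff_Iic,
      map_measureReal_apply_of_aemeasurable hn measurableSet_Ioc]
    rfl
  refine Metric.tendsto_nhds.2 fun κ hκ => ?_
  let H : ℝ → ℝ := fun e => cdf G (-z₁ + e) - cdf G (-z₂ - e)
  have hH : Continuous H :=
    ((continuous_cdf G).comp (by fun_prop)).sub ((continuous_cdf G).comp (by fun_prop))
  have hz : z₁ < z₂ := by
    rw [← hmono.lt_iff_lt, hz₁, hz₂]; linarith
  obtain ⟨d, hd, hdc⟩ := Metric.continuousAt_iff.1 (hH.continuousAt (x := 0)) (κ / 3)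
    (by linarith)
  obtain ⟨ε, hε0, hε⟩ := exists_between (lt_min (div_pos hd three_pos)
    (div_pos (sub_pos.2 hz) (by norm_num : (0 : ℝ) < 6)))
  have hεd := hε.trans_le (min_le_left _ _)
  have hεz := hε.trans_le (min_le_right _ _)
  have hH0 : H 0 = 1 - δ := by simpa [H] using hlimit
  have hHp : |H (3 * ε) - H 0| < κ / 3 :=
    hdc (by rw [Real.dist_eq, sub_zero, abs_of_pos (by linarith)]; linarith)
  have hHm : |H (-(3 * ε)) - H 0| < κ / 3 :=
    hdc (by rw [Real.dist_eq, sub_zero, abs_neg, abs_of_pos (by linarith)]; linarith)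
  obtain ⟨η₁, hη₁, hq₁⟩ := exists_dBL_bound_quantile G hmono (z := z₁) (by linarith)
    (by linarith) hε0
  obtain ⟨η₂, hη₂, hq₂⟩ := exists_dBL_bound_quantile G hmono (z := z₂) (by linarith)
    (by linarith) hε0
  rw [hz₁] at hq₁
  rw [hz₂] at hq₂
  have hB := ((ENNReal.tendsto_toReal ENNReal.zero_ne_top).comp
    (hBvM (min η₁ η₂) (lt_min hη₁ hη₂))).eventually
      (gt_mem_nhds (show (0 : ENNReal).toReal < κ / 6 by simpa using hκ))
  have hD := ((ENNReal.tendsto_toReal ENNReal.zero_ne_top).comp (hbar ε hε0)).eventually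
      (gt_mem_nhds (show (0 : ENNReal).toReal < κ / 6 by simpa using hκ))
  have hup := Metric.tendsto_nhds.1 (hZlim (-z₂ - 3 * ε) (-z₁ + 3 * ε) (by linarith)) (κ / 3)
    (by linarith)
  have hlo := Metric.tendsto_nhds.1 (hZlim (-z₂ - -(3 * ε)) (-z₁ + -(3 * ε)) (by linarith))
    (κ / 3) (by linarith)
  filter_upwards [hB, hD, hup, hlo, eventually_gt_atTop 0] with n hBn hDn hupn hlon hn
  have hn0 : (0 : ℝ) < Real.sqrt n := Real.sqrt_pos.2 (Nat.cast_pos.2 hn)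
  have hα0 : 0 < Real.sqrt (α n) := Real.sqrt_pos.2 (hα n).1
  have hα1 : Real.sqrt (α n) ≤ 1 := Real.sqrt_le_one.2 (hα n).2.le
  have hc : Real.sqrt ((n : ℝ) * α n) = Real.sqrt n * Real.sqrt (α n) :=
    Real.sqrt_mul (Nat.cast_nonneg n) _
  have hc0 : 0 < Real.sqrt ((n : ℝ) * α n) := by rw [hc]; positivity
  set B₁ : Set (Ω n) := {ω | min η₁ η₂ <
    dBL (Measure.map (fun x => Real.sqrt ((n : ℝ) * α n) * (x - ψhat n ω)) (μpost n ω)) G}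
  set B₂ : Set (Ω n) := {ω | ε < |Real.sqrt n * (ψbar n ω - ψhat n ω)|}
  set E : Set (Ω n) := {ω | ψ₀ ∈ Set.Ioc
    (Real.sqrt (α n) * (quantile (μpost n ω) (δ / 2) - ψbar n ω) + ψbar n ω)
    (Real.sqrt (α n) * (quantile (μpost n ω) (1 - δ / 2) - ψbar n ω) + ψbar n ω)}
  have good : ∀ ω, ω ∉ B₁ → ω ∉ B₂ →
      (ω ∈ E → Z n ω ∈ Ioc (-z₂ - 3 * ε) (-z₁ + 3 * ε)) ∧
      (Z n ω ∈ Ioc (-z₂ - -(3 * ε)) (-z₁ + -(3 * ε)) → ω ∈ E) := by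
    intro ω h₁ h₂
    simp only [B₁, B₂, mem_ofPred_eq, not_lt] at h₁ h₂
    have := hμprob n ω
    have q₁ := abs_le.1 (hq₁ (μpost n ω) _ (ψhat n ω) hc0 (h₁.trans (min_le_left _ _)))
    have q₂ := abs_le.1 (hq₂ (μpost n ω) _ (ψhat n ω) hc0 (h₁.trans (min_le_right _ _)))
    have hr : |(1 - Real.sqrt (α n)) * (Real.sqrt n * (ψbar n ω - ψhat n ω))| ≤ ε := by
      rw [abs_mul, abs_of_nonneg (sub_nonneg.2 hα1)]
      exact (mul_le_of_le_one_left (abs_nonneg _) (by linarith)).trans h₂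
    have hr := abs_le.1 hr
    have hid : ∀ a : ℝ,
        Real.sqrt n * ((Real.sqrt (α n) * (a - ψbar n ω) + ψbar n ω) - ψ₀) =
          Real.sqrt ((n : ℝ) * α n) * (a - ψhat n ω) +
            (1 - Real.sqrt (α n)) * (Real.sqrt n * (ψbar n ω - ψhat n ω)) + Z n ω := by
      intro a
      rw [hc]
      simp only [Z]
      ring
    have i₁ := hid (quantile (μpost n ω) (δ / 2))
    have i₂ := hid (quantile (μpost n ω) (1 - δ / 2))
    constructor
    · rintro ⟨e₁, e₂⟩
      have e₁ := mul_neg_of_pos_of_neg hn0 (sub_neg.2 e₁)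
      have e₂ := mul_nonneg hn0.le (sub_nonneg.2 e₂)
      constructor <;> linarith
    · rintro ⟨e₁, e₂⟩
      constructor
      · refine sub_neg.1 (neg_of_mul_neg_right ?_ hn0.le)
        linarith
      · refine sub_nonneg.1 (nonneg_of_mul_nonneg_right ?_ hn0)
        linarith
  have hsub₁ : E ⊆ {ω | Z n ω ∈ Ioc (-z₂ - 3 * ε) (-z₁ + 3 * ε)} ∪ (B₁ ∪ B₂) := by
    intro ω hω
    by_cases h : ω ∈ B₁ ∪ B₂
    · exact Or.inr h
    · exact Or.inl ((good ω (fun h' => h (Or.inl h')) (fun h' => h (Or.inr h'))).1 hω)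
  have hsub₂ : {ω | Z n ω ∈ Ioc (-z₂ - -(3 * ε)) (-z₁ + -(3 * ε))} ⊆ E ∪ (B₁ ∪ B₂) := by
    intro ω hω
    by_cases h : ω ∈ B₁ ∪ B₂
    · exact Or.inr h
    · exact Or.inl ((good ω (fun h' => h (Or.inl h')) (fun h' => h (Or.inr h'))).2 hω)
  have m₁ := (measureReal_mono (μ := P n) hsub₁).trans (measureReal_union_le _ _)
  have m₂ := (measureReal_mono (μ := P n) hsub₂).trans (measureReal_union_le _ _)
  have m₃ := measureReal_union_le (μ := P n) B₁ B₂
  have hBn : (P n).real B₁ < κ / 6 := hBn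
  have hDn : (P n).real B₂ < κ / 6 := hDn
  rw [Real.dist_eq, abs_lt] at hupn hlon
  rw [hH0, abs_lt] at hHp hHm
  change dist ((P n).real E) (1 - δ) < κ
  rw [Real.dist_eq, abs_lt]
  simp only [H] at hHp hHm
  constructor <;> linarith [hupn.1, hupn.2, hlon.1, hlon.2, hHp.1, hHp.2, hHm.1, hHm.2]
end

section
/- Asymptotics of the deterministic bias series for the conjugate Gaussian posterior mean: Let γ > 0, s > 1/2 + γ, and let 0 < α_n ≤ 1 with n α_n → ∞. Define T_n = √n ∑_{k=1}^∞ k^{−1−s} / (1 + n α_n k^{−1−2γ}). Then: (1) if s > 1 + 2γ, T_n → 0 if and only if √n α_n → ∞; (2) if s = 1 + 2γ, T_n → 0 if and only if (√n / log n) α_n → ∞; (3) if 1/2 + γ < s < 1 + 2γ, T_n → 0 if and only if n^{1 − (1+2γ)/(2s)} α_n → ∞. Moreover, with k* = (n α_n)^{1/(1+2γ)}, one has T_n ≍ (1/(√n α_n)) ∑_{1 ≤ k ≤ k*} k^{−(s − 2γ)} + √n (n α_n)^{−s/(1+2γ)} up to constants depending only on s and γ. -/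
open Filter

/-- The deterministic bias series
`Tₙ = √n ∑_{k≥1} k^{−1−s} / (1 + n αₙ k^{−1−2γ})` (indices shifted so that `k ∈ ℕ` stands
for `k+1 ≥ 1`). -/
noncomputable def biasSeries (s γ : ℝ) (α : ℕ → ℝ) (n : ℕ) : ℝ :=
  Real.sqrt n * ∑' k : ℕ,
    ((k : ℝ) + 1) ^ (-(1 : ℝ) - s) / (1 + (n : ℝ) * α n * ((k : ℝ) + 1) ^ (-(1 : ℝ) - 2 * γ))

/-- The two-term bound
`Bₙ = (1/(√n αₙ)) ∑_{1 ≤ k ≤ k*} k^{−(s−2γ)} + √n (n αₙ)^{−s/(1+2γ)}`, with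
`k* = (n αₙ)^{1/(1+2γ)}`. -/
noncomputable def biasBound (s γ : ℝ) (α : ℕ → ℝ) (n : ℕ) : ℝ :=
  (1 / (Real.sqrt n * α n)) *
      ∑ k ∈ Finset.Icc 1 ⌊((n : ℝ) * α n) ^ (1 / (1 + 2 * γ))⌋₊, (k : ℝ) ^ (-(s - 2 * γ))
    + Real.sqrt n * ((n : ℝ) * α n) ^ (-(s / (1 + 2 * γ)))

lemma mul_rpow_le_rpow_neg_sub {s y : ℝ} (hs : 0 < s) (hy : 0 < y) :
    s * (y + 1) ^ (-1 - s) ≤ y ^ (-s) - (y + 1) ^ (-s) := by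
  have hy1 : 0 < y + 1 := by linarith
  have hz : 0 < y / (y + 1) := by positivity
  have hlog := Real.log_le_sub_one_of_pos hz
  have hbern : 1 + s / (y + 1) ≤ (y / (y + 1)) ^ (-s) := by
    rw [Real.rpow_def_of_pos hz]
    have hexp := Real.add_one_le_exp (Real.log (y / (y + 1)) * -s)
    have hsub : y / (y + 1) - 1 = -(1 / (y + 1)) := by field_simp; ring
    have hmul : s * Real.log (y / (y + 1)) ≤ s * -(1 / (y + 1)) :=
      mul_le_mul_of_nonneg_left (hsub ▸ hlog) hs.le
    have hdiv : s * -(1 / (y + 1)) = -(s / (y + 1)) := by ring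
    linarith
  have hpos : 0 < (y + 1) ^ (-s) := by positivity
  have hsplit : y ^ (-s) = (y + 1) ^ (-s) * (y / (y + 1)) ^ (-s) := by
    rw [← Real.mul_rpow hy1.le hz.le]
    congr 1
    field_simp
  have hpow : (y + 1) ^ (-1 - s) = (y + 1) ^ (-s) / (y + 1) := by
    rw [← Real.rpow_sub_one hy1.ne']
    congr 1
    ring
  have hfin := mul_le_mul_of_nonneg_left hbern hpos.le
  rw [hsplit, hpow]
  calc s * ((y + 1) ^ (-s) / (y + 1))
      = (y + 1) ^ (-s) * (1 + s / (y + 1)) - (y + 1) ^ (-s) := by ring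
    _ ≤ _ := by linarith

lemma mul_rpow_sub_one_le_rpow_sub {q y : ℝ} (hq : 0 < q) (hq1 : q ≤ 1) (hy : 0 ≤ y) :
    q * (y + 1) ^ (q - 1) ≤ (y + 1) ^ q - y ^ q := by
  have hy1 : 0 < y + 1 := by linarith
  have hz : 0 ≤ y / (y + 1) := by positivity
  have hbern : (y / (y + 1)) ^ q ≤ 1 - q / (y + 1) := by
    have h := rpow_one_add_le_one_add_mul_self (s := y / (y + 1) - 1) (by linarith) hq.le hq1
    have hsub : y / (y + 1) - 1 = -(1 / (y + 1)) := by field_simp; ring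
    calc (y / (y + 1)) ^ q = (1 + (y / (y + 1) - 1)) ^ q := by congr 1; ring
      _ ≤ _ := h
      _ = 1 - q / (y + 1) := by rw [hsub]; ring
  have hpos : 0 < (y + 1) ^ q := by positivity
  have hsplit : y ^ q = (y + 1) ^ q * (y / (y + 1)) ^ q := by
    rw [← Real.mul_rpow hy1.le hz]
    congr 1
    field_simp
  have hfin := mul_le_mul_of_nonneg_left hbern hpos.le
  rw [hsplit, Real.rpow_sub_one hy1.ne']
  calc q * ((y + 1) ^ q / (y + 1)) = (y + 1) ^ q - (y + 1) ^ q * (1 - q / (y + 1)) := by ring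
    _ ≤ _ := by linarith

lemma sum_Icc_one_eq_sum_range (f : ℕ → ℝ) (M : ℕ) :
    ∑ k ∈ Finset.Icc 1 M, f k = ∑ i ∈ Finset.range M, f (i + 1) := by
  rw [Finset.range_eq_Ico, Finset.sum_Ico_add' f 0 M 1]
  rfl

/-- Power sums with exponent above `-1` are at most of the order of the integral. -/
lemma sum_Icc_rpow_sub_one_le {q x : ℝ} (hq : 0 < q) (hx : 0 ≤ x) :
    ∑ k ∈ Finset.Icc 1 ⌊x⌋₊, (k : ℝ) ^ (q - 1) ≤ (1 + 1 / q) * x ^ q := by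
  have hfloor : (⌊x⌋₊ : ℝ) ≤ x := Nat.floor_le hx
  have hxq : 0 ≤ x ^ q := by positivity
  rcases le_total q 1 with hq1 | hq1
  · have hsum : q * ∑ k ∈ Finset.Icc 1 ⌊x⌋₊, (k : ℝ) ^ (q - 1) ≤ x ^ q := by
      rw [sum_Icc_one_eq_sum_range (fun k => (k : ℝ) ^ (q - 1)), Finset.mul_sum]
      calc ∑ i ∈ Finset.range ⌊x⌋₊, q * ((i + 1 : ℕ) : ℝ) ^ (q - 1)
          ≤ ∑ i ∈ Finset.range ⌊x⌋₊, (((i + 1 : ℕ) : ℝ) ^ q - (i : ℝ) ^ q) := by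
            refine Finset.sum_le_sum fun i _ => ?_
            push_cast
            exact mul_rpow_sub_one_le_rpow_sub hq hq1 i.cast_nonneg
        _ = (⌊x⌋₊ : ℝ) ^ q := by
            rw [Finset.sum_range_sub (fun i : ℕ => (i : ℝ) ^ q)]
            simp [Real.zero_rpow hq.ne']
        _ ≤ x ^ q := by gcongr
    calc ∑ k ∈ Finset.Icc 1 ⌊x⌋₊, (k : ℝ) ^ (q - 1) ≤ 1 / q * x ^ q := by
          rw [one_div_mul_eq_div, le_div_iff₀ hq]
          linarith
      _ ≤ _ := by nlinarith
  · have hx' : x ^ (q - 1) * x = x ^ q := by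
      rcases hx.eq_or_lt with rfl | hx0
      · simp [Real.zero_rpow hq.ne']
      · rw [← Real.rpow_add_one hx0.ne']
        congr 1
        ring
    calc ∑ k ∈ Finset.Icc 1 ⌊x⌋₊, (k : ℝ) ^ (q - 1)
        ≤ ∑ k ∈ Finset.Icc 1 ⌊x⌋₊, x ^ (q - 1) := by
          refine Finset.sum_le_sum fun k hk => ?_
          have hkx : (k : ℝ) ≤ x := (Nat.le_floor_iff hx).1 (Finset.mem_Icc.1 hk).2
          exact Real.rpow_le_rpow k.cast_nonneg hkx (by linarith)
      _ = ⌊x⌋₊ * x ^ (q - 1) := by simp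
      _ ≤ x * x ^ (q - 1) := by gcongr
      _ = x ^ q := by rw [mul_comm, hx']
      _ ≤ _ := by
          have : 0 ≤ 1 / q * x ^ q := by positivity
          linarith

lemma summable_add_one_rpow {s : ℝ} (hs : 0 < s) :
    Summable fun k : ℕ => ((k : ℝ) + 1) ^ (-1 - s) := by
  have h := (summable_nat_add_iff 1).2 (Real.summable_nat_rpow.2 (by linarith : -1 - s < -1))
  simpa using h

lemma tsum_rpow_tail_le {s : ℝ} (hs : 0 < s) {M : ℕ} (hM : 0 < M) :
    ∑' i : ℕ, (((i + M : ℕ) : ℝ) + 1) ^ (-1 - s) ≤ 1 / s * (M : ℝ) ^ (-s) := by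
  refine Real.tsum_le_of_sum_range_le (fun i => by positivity) fun m => ?_
  rw [one_div_mul_eq_div, le_div_iff₀' hs, Finset.mul_sum]
  calc ∑ i ∈ Finset.range m, s * (((i + M : ℕ) : ℝ) + 1) ^ (-1 - s)
      ≤ ∑ i ∈ Finset.range m, (((i + M : ℕ) : ℝ) ^ (-s) - ((i + 1 + M : ℕ) : ℝ) ^ (-s)) := by
        refine Finset.sum_le_sum fun i _ => ?_
        have hpos : (0 : ℝ) < (i + M : ℕ) := by positivity
        have h := mul_rpow_le_rpow_neg_sub hs hpos
        have hcast : ((i + 1 + M : ℕ) : ℝ) = ((i + M : ℕ) : ℝ) + 1 := by push_cast; ring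
        rwa [hcast]
    _ = (M : ℝ) ^ (-s) - ((m + M : ℕ) : ℝ) ^ (-s) := by
        rw [Finset.sum_range_sub' (fun i : ℕ => ((i + M : ℕ) : ℝ) ^ (-s))]
        simp
    _ ≤ (M : ℝ) ^ (-s) := by
        have : 0 ≤ ((m + M : ℕ) : ℝ) ^ (-s) := by positivity
        linarith

lemma le_tsum_rpow_tail {s : ℝ} (hs : 0 < s) {M : ℕ} (hM : 0 < M) :
    2 ^ (-1 - s) * (M : ℝ) ^ (-s) ≤ ∑' i : ℕ, (((i + M : ℕ) : ℝ) + 1) ^ (-1 - s) := by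
  have hM' : (0 : ℝ) < M := by exact_mod_cast hM
  have hsum : Summable fun i : ℕ => (((i + M : ℕ) : ℝ) + 1) ^ (-1 - s) :=
    (summable_nat_add_iff M).2 (summable_add_one_rpow hs)
  refine le_trans ?_ (hsum.sum_le_tsum (Finset.range M) fun i _ => by positivity)
  calc 2 ^ (-1 - s) * (M : ℝ) ^ (-s) = ∑ i ∈ Finset.range M, (2 * (M : ℝ)) ^ (-1 - s) := by
        rw [Finset.sum_const, Finset.card_range, nsmul_eq_mul,
          Real.mul_rpow zero_le_two hM'.le, show -s = (-1 - s) + 1 by ring,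
          Real.rpow_add_one hM'.ne']
        ring_nf
    _ ≤ _ := by
        refine Finset.sum_le_sum fun i hi => ?_
        refine Real.rpow_le_rpow_of_nonpos (by positivity) ?_ (by linarith)
        have : ((i + M + 1 : ℕ) : ℝ) ≤ (2 * M : ℕ) := by
          exact_mod_cast (by have := Finset.mem_range.1 hi; omega)
        push_cast at this ⊢
        linarith

/-- Two-sided bound for the bias series with `N = n αₙ` and without the factor `√n`, where
`p = 1 + 2γ`. -/
lemma tsum_div_one_add_bounds {s p N : ℝ} (hs : 0 < s) (hp : 0 < p) (hN : 1 ≤ N) :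
    2 ^ (-2 - s) * (1 / N * ∑ k ∈ Finset.Icc 1 ⌊N ^ (1 / p)⌋₊, (k : ℝ) ^ (p - 1 - s)
        + N ^ (-(s / p)))
      ≤ ∑' k : ℕ, ((k : ℝ) + 1) ^ (-1 - s) / (1 + N * ((k : ℝ) + 1) ^ (-p)) ∧
    ∑' k : ℕ, ((k : ℝ) + 1) ^ (-1 - s) / (1 + N * ((k : ℝ) + 1) ^ (-p))
      ≤ (1 + 2 ^ s / s) * (1 / N * ∑ k ∈ Finset.Icc 1 ⌊N ^ (1 / p)⌋₊, (k : ℝ) ^ (p - 1 - s)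
        + N ^ (-(s / p))) := by
  have hN0 : 0 < N := by linarith
  set x := N ^ (1 / p) with hx
  have hx1 : 1 ≤ x := Real.one_le_rpow hN (by positivity)
  have hx0 : 0 < x := by linarith
  have hxp : x ^ p = N := by
    rw [hx, ← Real.rpow_mul hN0.le, one_div_mul_cancel hp.ne', Real.rpow_one]
  have hxs : x ^ (-s) = N ^ (-(s / p)) := by
    rw [hx, ← Real.rpow_mul hN0.le]
    congr 1
    ring
  rw [← hxs]
  set M := ⌊x⌋₊
  have hM0 : 0 < M := Nat.floor_pos.2 hx1
  have hM0' : (0 : ℝ) < M := by exact_mod_cast hM0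
  have hM1' : (1 : ℝ) ≤ M := by exact_mod_cast hM0
  have hMx : (M : ℝ) ≤ x := Nat.floor_le hx0.le
  have hxM : x < M + 1 := Nat.lt_floor_add_one x
  set g : ℕ → ℝ := fun k => ((k : ℝ) + 1) ^ (-1 - s) / (1 + N * ((k : ℝ) + 1) ^ (-p))
  have hgnn : ∀ k, 0 ≤ g k := fun k => by positivity
  have hgle : ∀ k, g k ≤ ((k : ℝ) + 1) ^ (-1 - s) := fun k =>
    div_le_self (by positivity) (by simp only [le_add_iff_nonneg_right]; positivity)
  have hgs : Summable g := Summable.of_nonneg_of_le hgnn hgle (summable_add_one_rpow hs)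
  have hNle : ∀ k : ℕ, k < M → 1 ≤ N * ((k : ℝ) + 1) ^ (-p) := fun k hk => by
    have hkx : (k : ℝ) + 1 ≤ x := le_trans (by exact_mod_cast hk) hMx
    rw [Real.rpow_neg (by positivity), ← div_eq_mul_inv, one_le_div (by positivity), ← hxp]
    gcongr
  have hNge : ∀ k : ℕ, M ≤ k → N * ((k : ℝ) + 1) ^ (-p) ≤ 1 := fun k hk => by
    have hkx : x ≤ (k : ℝ) + 1 := hxM.le.trans (by gcongr)
    rw [Real.rpow_neg (by positivity), ← div_eq_mul_inv, div_le_one (by positivity), ← hxp]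
    gcongr
  have hquot : ∀ k : ℕ, ((k : ℝ) + 1) ^ (-1 - s) / (N * ((k : ℝ) + 1) ^ (-p))
      = 1 / N * ((k : ℝ) + 1) ^ (p - 1 - s) := fun k => by
    have hk : (0 : ℝ) < (k : ℝ) + 1 := by positivity
    rw [show p - 1 - s = (-1 - s) - (-p) by ring, Real.rpow_sub hk (-1 - s) (-p)]
    ring
  have hS : 1 / N * ∑ k ∈ Finset.Icc 1 M, (k : ℝ) ^ (p - 1 - s)
      = ∑ i ∈ Finset.range M, 1 / N * ((i : ℝ) + 1) ^ (p - 1 - s) := by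
    rw [sum_Icc_one_eq_sum_range (fun k => (k : ℝ) ^ (p - 1 - s)), Finset.mul_sum]
    simp
  have hSnn : 0 ≤ 1 / N * ∑ k ∈ Finset.Icc 1 M, (k : ℝ) ^ (p - 1 - s) := by positivity
  have hhead_le : ∑ i ∈ Finset.range M, g i
      ≤ 1 / N * ∑ k ∈ Finset.Icc 1 M, (k : ℝ) ^ (p - 1 - s) := by
    rw [hS]
    refine Finset.sum_le_sum fun i _ => ?_
    rw [← hquot]
    refine div_le_div_of_nonneg_left (by positivity) (by positivity) (by linarith)
  have hhead_ge : 1 / 2 * (1 / N * ∑ k ∈ Finset.Icc 1 M, (k : ℝ) ^ (p - 1 - s))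
      ≤ ∑ i ∈ Finset.range M, g i := by
    rw [hS, Finset.mul_sum]
    refine Finset.sum_le_sum fun i hi => ?_
    have h1 := hNle i (Finset.mem_range.1 hi)
    rw [← hquot, div_mul_div_comm, one_mul]
    exact div_le_div_of_nonneg_left (by positivity) (by positivity) (by linarith)
  have htsum : Summable fun i : ℕ => (((i + M : ℕ) : ℝ) + 1) ^ (-1 - s) :=
    (summable_nat_add_iff M).2 (summable_add_one_rpow hs)
  have hgsM : Summable fun i => g (i + M) := (summable_nat_add_iff M).2 hgs
  have htail_le : ∑' i, g (i + M) ≤ 2 ^ s / s * x ^ (-s) := by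
    refine (hgsM.tsum_le_tsum (fun i => hgle (i + M)) htsum).trans
      ((tsum_rpow_tail_le hs hM0).trans ?_)
    have hhalf : (M : ℝ) ^ (-s) ≤ (x / 2) ^ (-s) :=
      Real.rpow_le_rpow_of_nonpos (by positivity) (by linarith) (by linarith)
    calc 1 / s * (M : ℝ) ^ (-s) ≤ 1 / s * (x / 2) ^ (-s) := by gcongr
      _ = 2 ^ s / s * x ^ (-s) := by
        rw [Real.div_rpow hx0.le zero_le_two, Real.rpow_neg zero_le_two]
        field_simp
  have htail_ge : 2 ^ (-2 - s) * x ^ (-s) ≤ ∑' i, g (i + M) := by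
    calc (2 : ℝ) ^ (-2 - s) * x ^ (-s) ≤ 2 ^ (-2 - s) * (M : ℝ) ^ (-s) := by
          refine mul_le_mul_of_nonneg_left ?_ (by positivity)
          exact Real.rpow_le_rpow_of_nonpos hM0' hMx (by linarith)
      _ = 1 / 2 * (2 ^ (-1 - s) * (M : ℝ) ^ (-s)) := by
          rw [show (-2 - s) = (-1 - s) - 1 by ring, Real.rpow_sub_one two_ne_zero]
          ring
      _ ≤ 1 / 2 * ∑' i : ℕ, (((i + M : ℕ) : ℝ) + 1) ^ (-1 - s) := by
          gcongr
          exact le_tsum_rpow_tail hs hM0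
      _ = ∑' i : ℕ, 1 / 2 * (((i + M : ℕ) : ℝ) + 1) ^ (-1 - s) := tsum_mul_left.symm
      _ ≤ _ := by
          refine (htsum.mul_left _).tsum_le_tsum (fun i => ?_) hgsM
          have h1 := hNge (i + M) (Nat.le_add_left M i)
          rw [one_div_mul_eq_div]
          exact div_le_div_of_nonneg_left (by positivity) (by positivity) (by linarith)
  have hsplit := hgs.sum_add_tsum_nat_add M
  have hhalf : (2 : ℝ) ^ (-2 - s) ≤ 1 / 2 := by
    calc (2 : ℝ) ^ (-2 - s) ≤ 2 ^ (-1 : ℝ) :=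
          Real.rpow_le_rpow_of_exponent_le one_le_two (by linarith)
      _ = 1 / 2 := by rw [Real.rpow_neg_one]; norm_num
  have hxsnn : 0 ≤ x ^ (-s) := by positivity
  have hc : 0 ≤ (2 : ℝ) ^ s / s := by positivity
  constructor
  · rw [← hsplit, mul_add]
    exact add_le_add ((mul_le_mul_of_nonneg_right hhalf hSnn).trans hhead_ge) htail_ge
  · rw [← hsplit]
    have := mul_nonneg hc hSnn
    nlinarith

lemma sqrt_mul_eq_inv {n : ℕ} {a : ℝ} :
    Real.sqrt n * (1 / (n * a)) = (Real.sqrt n * a)⁻¹ := by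
  rw [one_div, mul_inv, mul_inv, ← mul_assoc, ← div_eq_mul_inv (Real.sqrt n),
    Real.sqrt_div_self', one_div]

lemma biasBound_eq {s γ : ℝ} {α : ℕ → ℝ} {n : ℕ} :
    biasBound s γ α n = Real.sqrt n * (1 / (n * α n) *
        ∑ k ∈ Finset.Icc 1 ⌊((n : ℝ) * α n) ^ (1 / (1 + 2 * γ))⌋₊,
          (k : ℝ) ^ (1 + 2 * γ - 1 - s) + ((n : ℝ) * α n) ^ (-(s / (1 + 2 * γ)))) := by
  rw [biasBound, one_div (Real.sqrt n * α n), ← sqrt_mul_eq_inv, mul_add, ← mul_assoc,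
    show 1 + 2 * γ - 1 - s = -(s - 2 * γ) by ring]

lemma biasSeries_bounds {s γ : ℝ} {α : ℕ → ℝ} (hs : 0 < s) (hγ : 0 < γ) {n : ℕ}
    (hN : 1 ≤ (n : ℝ) * α n) :
    2 ^ (-2 - s) * biasBound s γ α n ≤ biasSeries s γ α n ∧
      biasSeries s γ α n ≤ (1 + 2 ^ s / s) * biasBound s γ α n := by
  have h := tsum_div_one_add_bounds hs (by positivity : 0 < 1 + 2 * γ) hN
  have hexp : -(1 : ℝ) - 2 * γ = -(1 + 2 * γ) := by ring
  rw [biasBound_eq, biasSeries, hexp, mul_left_comm, mul_left_comm (1 + 2 ^ s / s)]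
  exact ⟨mul_le_mul_of_nonneg_left h.1 (Real.sqrt_nonneg _),
    mul_le_mul_of_nonneg_left h.2 (Real.sqrt_nonneg _)⟩

/-- A sequence of exact order `u⁻¹` tends to zero if and only if `u` diverges. -/
lemma tendsto_zero_iff_of_le_inv {T u : ℕ → ℝ} {c : ℝ} (C : ℝ) (hc : 0 < c)
    (h : ∀ᶠ n in atTop, 0 < u n ∧ c * (u n)⁻¹ ≤ T n ∧ T n ≤ C * (u n)⁻¹) :
    Tendsto T atTop (nhds 0) ↔ Tendsto u atTop atTop := by
  constructor
  · intro hT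
    have hinv : Tendsto (fun n => (u n)⁻¹) atTop (nhds 0) := by
      refine squeeze_zero' (h.mono fun n hn => (inv_pos.2 hn.1).le)
        (h.mono fun n hn => ?_) (by simpa using hT.const_mul c⁻¹)
      rw [inv_mul_eq_div, le_div_iff₀' hc]
      exact hn.2.1
    have hinv' := tendsto_nhdsWithin_iff.2 ⟨hinv, h.mono fun n hn => inv_pos.2 hn.1⟩
    exact hinv'.inv_tendsto_nhdsGT_zero.congr fun n => inv_inv (u n)
  · intro hu
    refine squeeze_zero' (h.mono fun n hn => ?_) (h.mono fun n hn => hn.2.2)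
      (by simpa using (tendsto_inv_atTop_zero.comp hu).const_mul C)
    exact (mul_pos hc (inv_pos.2 hn.1)).le.trans hn.2.1

lemma tendsto_rpow_comp_atTop_iff {u : ℕ → ℝ} {r : ℝ} (hr : 0 < r) (hu : ∀ n, 0 ≤ u n) :
    Tendsto (fun n => u n ^ r) atTop atTop ↔ Tendsto u atTop atTop := by
  refine ⟨fun h => ?_, fun h => (tendsto_rpow_atTop hr).comp h⟩
  refine ((tendsto_rpow_atTop (inv_pos.2 hr)).comp h).congr fun n => ?_
  exact Real.rpow_rpow_inv (hu n) hr.ne'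

/-- A sum over `1 ≤ k ≤ M` of powers with exponent below `-1` is bounded. -/
lemma sum_Icc_rpow_le_tsum {r : ℝ} (hr : r < -1) (M : ℕ) :
    ∑ k ∈ Finset.Icc 1 M, (k : ℝ) ^ r ≤ ∑' k : ℕ, (k : ℝ) ^ r :=
  (Real.summable_nat_rpow.2 hr).sum_le_tsum _ fun _ _ => by positivity

lemma biasBound_bounds_of_gt {s γ : ℝ} {α : ℕ → ℝ} (hγ : 0 < γ) (hs : 1 + 2 * γ < s) {n : ℕ}
    (hN : 1 ≤ (n : ℝ) * α n) :
    (Real.sqrt n * α n)⁻¹ ≤ biasBound s γ α n ∧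
      biasBound s γ α n ≤
        (1 + ∑' k : ℕ, (k : ℝ) ^ (1 + 2 * γ - 1 - s)) * (Real.sqrt n * α n)⁻¹ := by
  have hp : 0 < 1 + 2 * γ := by positivity
  have hN0 : 0 < (n : ℝ) * α n := by linarith
  rw [biasBound_eq, ← sqrt_mul_eq_inv, mul_left_comm]
  set N := (n : ℝ) * α n
  set S := ∑ k ∈ Finset.Icc 1 ⌊N ^ (1 / (1 + 2 * γ))⌋₊, (k : ℝ) ^ (1 + 2 * γ - 1 - s)
  have hS1 : 1 ≤ S := by
    have hmem : 1 ∈ Finset.Icc 1 ⌊N ^ (1 / (1 + 2 * γ))⌋₊ :=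
      Finset.mem_Icc.2 ⟨le_rfl, Nat.floor_pos.2 (Real.one_le_rpow hN (by positivity))⟩
    have h := Finset.single_le_sum (f := fun k : ℕ => (k : ℝ) ^ (1 + 2 * γ - 1 - s))
      (fun k _ => by positivity) hmem
    rwa [Nat.cast_one, Real.one_rpow] at h
  have hSle : S ≤ ∑' k : ℕ, (k : ℝ) ^ (1 + 2 * γ - 1 - s) :=
    sum_Icc_rpow_le_tsum (by linarith) _
  have hpow : N ^ (-(s / (1 + 2 * γ))) ≤ 1 / N := by
    rw [one_div, ← Real.rpow_neg_one]
    refine Real.rpow_le_rpow_of_exponent_le hN (neg_le_neg ?_)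
    rw [one_le_div hp]
    exact hs.le
  have hpow0 : 0 ≤ N ^ (-(s / (1 + 2 * γ))) := by positivity
  have hinv : 0 < 1 / N := by positivity
  constructor <;> refine mul_le_mul_of_nonneg_left ?_ (Real.sqrt_nonneg _) <;> nlinarith

lemma biasBound_bounds_of_eq {s γ : ℝ} {α : ℕ → ℝ} (hγ : 0 < γ) (hs : s = 1 + 2 * γ) {n : ℕ}
    (hN : Real.exp 1 ≤ (n : ℝ) * α n) :
    1 / (1 + 2 * γ) * (Real.sqrt n * α n / Real.log (n * α n))⁻¹ ≤ biasBound s γ α n ∧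
      biasBound s γ α n ≤ 3 * (Real.sqrt n * α n / Real.log (n * α n))⁻¹ := by
  have hp : 0 < 1 + 2 * γ := by positivity
  have hN0 : 0 < (n : ℝ) * α n := (Real.exp_pos 1).trans_le hN
  have hN1 : 1 ≤ (n : ℝ) * α n := (Real.one_le_exp zero_le_one).trans hN
  have hlog : 1 ≤ Real.log (n * α n) := (Real.le_log_iff_exp_le hN0).2 hN
  rw [biasBound_eq, inv_div, div_eq_mul_inv (Real.log _), ← sqrt_mul_eq_inv]
  set N := (n : ℝ) * α n
  set x := N ^ (1 / (1 + 2 * γ)) with hx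
  have hx1 : 1 ≤ x := Real.one_le_rpow hN1 (by positivity)
  have hlogx : Real.log x = 1 / (1 + 2 * γ) * Real.log N := Real.log_rpow hN0 _
  have hS : ∑ k ∈ Finset.Icc 1 ⌊x⌋₊, (k : ℝ) ^ (1 + 2 * γ - 1 - s) = harmonic ⌊x⌋₊ := by
    rw [harmonic_eq_sum_Icc, hs]
    push_cast
    refine Finset.sum_congr rfl fun k _ => ?_
    rw [show 1 + 2 * γ - 1 - (1 + 2 * γ) = -1 by ring, Real.rpow_neg_one]
  have hlo := log_le_harmonic_floor x (by linarith)
  have hhi := harmonic_floor_le_one_add_log x hx1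
  have hpow : N ^ (-(s / (1 + 2 * γ))) = 1 / N := by
    rw [hs, div_self hp.ne', Real.rpow_neg_one, one_div]
  have hple : 1 / (1 + 2 * γ) * Real.log N ≤ 1 * Real.log N := by
    refine mul_le_mul_of_nonneg_right ?_ (by linarith)
    rw [div_le_one hp]
    linarith
  have hinv : 0 < 1 / N := by positivity
  have hsq := Real.sqrt_nonneg (n : ℝ)
  rw [hS, hpow]
  constructor
  · calc 1 / (1 + 2 * γ) * (Real.log N * (Real.sqrt n * (1 / N)))
        = Real.sqrt n * (1 / N * Real.log x) := by rw [hlogx]; ring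
      _ ≤ _ := by
        refine mul_le_mul_of_nonneg_left ?_ hsq
        nlinarith
  · calc Real.sqrt n * (1 / N * (harmonic ⌊x⌋₊ : ℝ) + 1 / N)
        ≤ Real.sqrt n * (1 / N * (3 * Real.log N)) := by
          refine mul_le_mul_of_nonneg_left ?_ hsq
          nlinarith
      _ = _ := by ring

lemma biasBound_bounds_of_lt {s γ : ℝ} {α : ℕ → ℝ} (hγ : 0 < γ) (hs : s < 1 + 2 * γ) {n : ℕ}
    (hs0 : 0 < s) (hα : 0 < α n) (hn : 0 < n) :
    (((n : ℝ) ^ (1 - (1 + 2 * γ) / (2 * s)) * α n) ^ (s / (1 + 2 * γ)))⁻¹ ≤ biasBound s γ α n ∧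
      biasBound s γ α n ≤ (2 + 1 / (1 + 2 * γ - s)) *
        (((n : ℝ) ^ (1 - (1 + 2 * γ) / (2 * s)) * α n) ^ (s / (1 + 2 * γ)))⁻¹ := by
  have hp : 0 < 1 + 2 * γ := by positivity
  have hn' : (0 : ℝ) < n := by exact_mod_cast hn
  have hN0 : 0 < (n : ℝ) * α n := by positivity
  have hmain : (((n : ℝ) ^ (1 - (1 + 2 * γ) / (2 * s)) * α n) ^ (s / (1 + 2 * γ)))⁻¹
      = Real.sqrt n * ((n : ℝ) * α n) ^ (-(s / (1 + 2 * γ))) := by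
    rw [Real.rpow_neg hN0.le, sub_eq_neg_add, Real.rpow_add_one hn'.ne', mul_assoc,
      Real.mul_rpow (by positivity) hN0.le, mul_inv, ← Real.rpow_mul hn'.le,
      ← Real.rpow_neg hn'.le, Real.sqrt_eq_rpow]
    congr 2
    field_simp
  rw [hmain, biasBound_eq, mul_left_comm]
  set N := (n : ℝ) * α n
  have hsum := sum_Icc_rpow_sub_one_le (q := 1 + 2 * γ - s) (x := N ^ (1 / (1 + 2 * γ)))
    (by linarith) (by positivity)
  rw [show 1 + 2 * γ - s - 1 = 1 + 2 * γ - 1 - s by ring] at hsum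
  have hpow : 1 / N * (N ^ (1 / (1 + 2 * γ))) ^ (1 + 2 * γ - s) = N ^ (-(s / (1 + 2 * γ))) := by
    rw [← Real.rpow_mul hN0.le, one_div, ← Real.rpow_neg_one, ← Real.rpow_add hN0]
    congr 1
    field_simp
    ring
  have hinv : 0 < 1 / N := by positivity
  have hsum' := mul_le_mul_of_nonneg_left hsum hinv.le
  rw [mul_left_comm, hpow] at hsum'
  have hSnn : 0 ≤ 1 / N * ∑ k ∈ Finset.Icc 1 ⌊N ^ (1 / (1 + 2 * γ))⌋₊,
      (k : ℝ) ^ (1 + 2 * γ - 1 - s) := by positivity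
  constructor <;> refine mul_le_mul_of_nonneg_left ?_ (Real.sqrt_nonneg _) <;> linarith

/-- In the critical case the logarithms of `n` and of `n αₙ` are interchangeable. -/
lemma tendsto_sqrt_mul_div_log_iff {α : ℕ → ℝ} (hα : ∀ n, 0 < α n ∧ α n ≤ 1)
    (hnα : Tendsto (fun n : ℕ => (n : ℝ) * α n) atTop atTop) :
    Tendsto (fun n : ℕ => Real.sqrt n * α n / Real.log (n * α n)) atTop atTop ↔
      Tendsto (fun n : ℕ => Real.sqrt n / Real.log n * α n) atTop atTop := by
  have hev : ∀ᶠ n : ℕ in atTop, 0 < (n : ℝ) ∧ 1 ≤ Real.log (n * α n) ∧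
      Real.log (n * α n) ≤ Real.log n := by
    filter_upwards [hnα.eventually_ge_atTop (Real.exp 1), eventually_gt_atTop 0] with n hN hn
    have hn' : (0 : ℝ) < n := by exact_mod_cast hn
    have hN0 := mul_pos hn' (hα n).1
    exact ⟨hn', (Real.le_log_iff_exp_le hN0).2 hN,
      Real.log_le_log hN0 (mul_le_of_le_one_right hn'.le (hα n).2)⟩
  constructor
  · intro h
    refine tendsto_atTop_mono' atTop ?_ (h.const_mul_atTop (by norm_num : (0 : ℝ) < 1 / 2))
    filter_upwards [hev, h.eventually_ge_atTop 1] with n ⟨hn, hlog, hle⟩ hge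
    have hα0 := (hα n).1
    have hsq : 1 ≤ Real.sqrt n * α n := by
      rw [le_div_iff₀ (by linarith)] at hge
      linarith
    have hsqrt : Real.sqrt n ≤ n * α n := by
      calc Real.sqrt n ≤ Real.sqrt n * (Real.sqrt n * α n) :=
            le_mul_of_one_le_right (Real.sqrt_nonneg _) hsq
        _ = n * α n := by rw [← mul_assoc, Real.mul_self_sqrt hn.le]
    have hlog2 : Real.log n ≤ 2 * Real.log (n * α n) := by
      have := Real.log_le_log (Real.sqrt_pos.2 hn) hsqrt
      rw [Real.log_sqrt hn.le] at this
      linarith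
    calc 1 / 2 * (Real.sqrt n * α n / Real.log (n * α n))
        = Real.sqrt n * α n / (2 * Real.log (n * α n)) := by field_simp
      _ ≤ Real.sqrt n * α n / Real.log n :=
          div_le_div_of_nonneg_left (by positivity) (by linarith) hlog2
      _ = _ := by ring
  · intro h
    refine tendsto_atTop_mono' atTop ?_ h
    filter_upwards [hev] with n ⟨hn, hlog, hle⟩
    have hα0 := (hα n).1
    calc Real.sqrt n / Real.log n * α n = Real.sqrt n * α n / Real.log n := by ring
      _ ≤ _ := div_le_div_of_nonneg_left (by positivity) (by linarith) hle

/-- **Asymptotics of the deterministic bias series for the conjugate Gaussian posterior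
mean.** For `γ > 0`, `s > 1/2 + γ` and `0 < αₙ ≤ 1` with `n αₙ → ∞`: (1) if `s > 1 + 2γ`,
`Tₙ → 0 ↔ √n αₙ → ∞`; (2) if `s = 1 + 2γ`, `Tₙ → 0 ↔ (√n/log n) αₙ → ∞`; (3) if
`1/2 + γ < s < 1 + 2γ`, `Tₙ → 0 ↔ n^{1−(1+2γ)/(2s)} αₙ → ∞`. Moreover `Tₙ ≍ Bₙ` up to
constants depending only on `s` and `γ`. -/
theorem bias_series_asymptotics
    (γ s : ℝ) (hγ : 0 < γ) (hs : 1 / 2 + γ < s)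
    (α : ℕ → ℝ) (hα : ∀ n, 0 < α n ∧ α n ≤ 1)
    (hnα : Tendsto (fun n : ℕ => (n : ℝ) * α n) atTop atTop) :
    -- (1)
    (1 + 2 * γ < s →
      (Tendsto (biasSeries s γ α) atTop (nhds 0) ↔
        Tendsto (fun n : ℕ => Real.sqrt n * α n) atTop atTop)) ∧
    -- (2)
    (s = 1 + 2 * γ →
      (Tendsto (biasSeries s γ α) atTop (nhds 0) ↔
        Tendsto (fun n : ℕ => Real.sqrt n / Real.log n * α n) atTop atTop)) ∧
    -- (3)
    (s < 1 + 2 * γ →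
      (Tendsto (biasSeries s γ α) atTop (nhds 0) ↔
        Tendsto (fun n : ℕ => (n : ℝ) ^ (1 - (1 + 2 * γ) / (2 * s)) * α n) atTop atTop)) ∧
    -- `Tₙ ≍ Bₙ`
    (∃ c C : ℝ, 0 < c ∧ c ≤ C ∧ ∀ᶠ n in atTop,
      c * biasBound s γ α n ≤ biasSeries s γ α n ∧
      biasSeries s γ α n ≤ C * biasBound s γ α n) := by
  have hs0 : 0 < s := by linarith
  have hc : (0 : ℝ) < 2 ^ (-2 - s) := by positivity
  have hC : 0 < 1 + 2 ^ s / s := by positivity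
  have hbounds : ∀ᶠ n in atTop, 2 ^ (-2 - s) * biasBound s γ α n ≤ biasSeries s γ α n ∧
      biasSeries s γ α n ≤ (1 + 2 ^ s / s) * biasBound s γ α n := by
    filter_upwards [hnα.eventually_ge_atTop 1] with n hN
    exact biasSeries_bounds hs0 hγ hN
  refine ⟨fun hs1 => ?_, fun hs1 => ?_, fun hs1 => ?_, 2 ^ (-2 - s), 1 + 2 ^ s / s, hc, ?_,
    hbounds⟩
  · refine tendsto_zero_iff_of_le_inv
      ((1 + 2 ^ s / s) * (1 + ∑' k : ℕ, (k : ℝ) ^ (1 + 2 * γ - 1 - s))) hc ?_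
    filter_upwards [hbounds, hnα.eventually_ge_atTop 1, eventually_gt_atTop 0] with n hb hN hn
    have h := biasBound_bounds_of_gt hγ hs1 hN
    have hα0 := (hα n).1
    refine ⟨by positivity, (mul_le_mul_of_nonneg_left h.1 hc.le).trans hb.1, hb.2.trans ?_⟩
    rw [mul_assoc]
    exact mul_le_mul_of_nonneg_left h.2 hC.le
  · rw [← tendsto_sqrt_mul_div_log_iff hα hnα]
    have hK : 0 < 1 / (1 + 2 * γ) := by positivity
    refine tendsto_zero_iff_of_le_inv ((1 + 2 ^ s / s) * 3) (mul_pos hc hK) ?_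
    filter_upwards [hbounds, hnα.eventually_ge_atTop (Real.exp 1), eventually_gt_atTop 0]
      with n hb hN hn
    have h := biasBound_bounds_of_eq hγ hs1 hN
    have hα0 := (hα n).1
    have hlog : 0 < Real.log (n * α n) :=
      Real.log_pos ((Real.one_lt_exp_iff.2 one_pos).trans_le hN)
    rw [mul_assoc, mul_assoc]
    exact ⟨by positivity, (mul_le_mul_of_nonneg_left h.1 hc.le).trans hb.1,
      hb.2.trans (mul_le_mul_of_nonneg_left h.2 hC.le)⟩
  · have hα' : ∀ n, 0 ≤ α n := fun n => (hα n).1.le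
    rw [← tendsto_rpow_comp_atTop_iff (by positivity : 0 < s / (1 + 2 * γ))
      fun n => mul_nonneg (by positivity) (hα' n)]
    refine tendsto_zero_iff_of_le_inv
      ((1 + 2 ^ s / s) * (2 + 1 / (1 + 2 * γ - s))) hc ?_
    filter_upwards [hbounds, eventually_gt_atTop 0] with n hb hn
    have hα0 := (hα n).1
    have h := biasBound_bounds_of_lt hγ hs1 hs0 hα0 hn
    rw [mul_assoc]
    exact ⟨by positivity, (mul_le_mul_of_nonneg_left h.1 hc.le).trans hb.1,
      hb.2.trans (mul_le_mul_of_nonneg_left h.2 hC.le)⟩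
  · have hle : (2 : ℝ) ^ (-2 - s) ≤ 1 :=
      Real.rpow_le_one_of_one_le_of_nonpos one_le_two (by linarith)
    have hpos : 0 ≤ (2 : ℝ) ^ s / s := by positivity
    linarith
end
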